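/- arXiv:1308.2173 — 2 statements merged into one kernel-verified Lean document; each statement's English description precedes it below -/
import Mathlib

section
/- Let 0 ≤ t ≤ T, n > 0, and let v, v̂ : [t,T] → ℝ^d be continuous. Suppose x̂, x̄ : [t,T] → ℝ^d are continuous and satisfy x̂(s) = v̂(s) − n ∫_t^s δ(x̂(r)) dr and x̄(s) = v(s) − n ∫_t^s δ(x̄(r)) dr for all s ∈ [t,T]. Then for every s ∈ [t,T], ‖x̂(s) − x̄(s)‖² ≤ ‖v̂(s) − v(s)‖² + 2 n ∫_t^s ‖(v̂(s) − v(s)) − (v̂(r) − v(r))‖ · ‖δ(x̂(r)) − δ(x̄(r))‖ dr. -/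
open Set intervalIntegral

/-- If `p` and `q` are nearest points of a convex set `C` to `x` and `y`, then the residuals
`x - p` and `y - q` depend on `x` and `y` in a firmly nonexpansive way. -/
theorem Convex.norm_residual_sub_sq_le_inner {E : Type*} [NormedAddCommGroup E]
    [InnerProductSpace ℝ E] {C : Set E} (hC : Convex ℝ C) {x y p q : E} (hp : p ∈ C) (hq : q ∈ C)
    (hxp : ‖x - p‖ = Metric.infDist x C) (hyq : ‖y - q‖ = Metric.infDist y C) :
    ‖(x - p) - (y - q)‖ ^ 2 ≤ inner ℝ (x - y) ((x - p) - (y - q)) := by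
  simp only [Metric.infDist_eq_iInf, dist_eq_norm] at hxp hyq
  have h1 := (norm_eq_iInf_iff_real_inner_le_zero hC hp).1 hxp q hq
  have h2 := (norm_eq_iInf_iff_real_inner_le_zero hC hq).1 hyq p hp
  have h3 : inner ℝ (x - y) ((x - p) - (y - q)) - ‖(x - p) - (y - q)‖ ^ 2
      = -inner ℝ (x - p) (q - p) - inner ℝ (y - q) (p - q) := by
    rw [← real_inner_self_eq_norm_sq, ← inner_sub_left, real_inner_comm,
      show x - y - (x - p - (y - q)) = p - q by abel, inner_sub_left (x - p),
      ← neg_sub p q, inner_neg_right, neg_neg]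
  linarith

/-- The chain rule for the squared norm of the primitive of a continuous function. -/
theorem norm_intervalIntegral_sq_eq {E : Type*} [NormedAddCommGroup E]
    [InnerProductSpace ℝ E] [CompleteSpace E] {f : ℝ → E} {a b : ℝ} (hab : a ≤ b)
    (hf : ContinuousOn f (Icc a b)) :
    ‖∫ r in a..b, f r‖ ^ 2 = 2 * ∫ r in a..b, inner ℝ (∫ u in a..r, f u) (f r) := by
  have hK : ContinuousOn (fun r => ∫ u in a..r, f u) (Icc a b) := by
    have h := continuousOn_primitive_interval' (μ := MeasureTheory.volume)
      (hf.intervalIntegrable_of_Icc hab) left_mem_uIcc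
    rwa [uIcc_of_le hab] at h
  have hderiv : ∀ r ∈ Ioo a b, HasDerivAt (fun r => ‖∫ u in a..r, f u‖ ^ 2)
      (2 * inner ℝ (∫ u in a..r, f u) (f r)) r := by
    intro r hr
    have hnhds : Icc a b ∈ nhds r := Icc_mem_nhds hr.1 hr.2
    have hfr : ContinuousOn f (Icc a r) := hf.mono (Icc_subset_Icc_right hr.2.le)
    exact (integral_hasDerivAt_right (hfr.intervalIntegrable_of_Icc hr.1.le)
      ((hf.mono Ioo_subset_Icc_self).stronglyMeasurableAtFilter isOpen_Ioo r hr)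
      (hf.continuousAt hnhds)).norm_sq
  have hint := integral_eq_sub_of_hasDerivAt_of_le hab (hK.norm.pow 2) hderiv
    (((hK.inner (𝕜 := ℝ) hf).const_mul 2).intervalIntegrable_of_Icc hab)
  rw [integral_const_mul] at hint
  rw [hint]
  simp

/-- Tanaka's estimate: if `y = w - n • ∫ D` with `y` and `D` positively correlated at each time,
then the norm of `y` is controlled by the oscillation of `w`. -/
theorem norm_sq_le_of_eq_sub_smul_integral {E : Type*} [NormedAddCommGroup E]
    [InnerProductSpace ℝ E] [CompleteSpace E] {w y D : ℝ → E} {a b n : ℝ} (hab : a ≤ b)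
    (hn : 0 ≤ n) (hw : ContinuousOn w (Icc a b)) (hD : ContinuousOn D (Icc a b))
    (hy : ∀ r ∈ Icc a b, y r = w r - n • ∫ u in a..r, D u)
    (hyD : ∀ r ∈ Icc a b, 0 ≤ inner ℝ (y r) (D r)) :
    ‖y b‖ ^ 2 ≤ ‖w b‖ ^ 2 + 2 * n * ∫ r in a..b, ‖w b - w r‖ * ‖D r‖ := by
  have hK : ContinuousOn (fun r => ∫ u in a..r, D u) (Icc a b) := by
    have h := continuousOn_primitive_interval' (μ := MeasureTheory.volume)
      (hD.intervalIntegrable_of_Icc hab) left_mem_uIcc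
    rwa [uIcc_of_le hab] at h
  have hDi := hD.intervalIntegrable_of_Icc (μ := MeasureTheory.volume) hab
  have hKD := (hK.inner (𝕜 := ℝ) hD).intervalIntegrable_of_Icc (μ := MeasureTheory.volume) hab
  have hwD := ((continuousOn_const (c := w b)).inner (𝕜 := ℝ) hD).intervalIntegrable_of_Icc
    (μ := MeasureTheory.volume) hab
  have hexp : ‖y b‖ ^ 2 = ‖w b‖ ^ 2 - 2 * n * inner ℝ (w b) (∫ u in a..b, D u)
      + n ^ 2 * ‖∫ u in a..b, D u‖ ^ 2 := by
    rw [hy b (right_mem_Icc.2 hab), norm_sub_sq_real, norm_smul, inner_smul_right, mul_pow,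
      Real.norm_eq_abs, sq_abs]
    ring
  have hinner : inner ℝ (w b) (∫ u in a..b, D u) = ∫ r in a..b, inner ℝ (w b) (D r) :=
    ((innerSL ℝ (w b)).intervalIntegral_comp_comm hDi).symm
  have hle : n * (∫ r in a..b, inner ℝ (∫ u in a..r, D u) (D r))
      - (∫ r in a..b, inner ℝ (w b) (D r)) ≤ ∫ r in a..b, ‖w b - w r‖ * ‖D r‖ := by
    rw [← integral_const_mul, ← integral_sub (hKD.const_mul n) hwD]
    refine integral_mono_on hab ((hKD.const_mul n).sub hwD)
      (((continuousOn_const.sub hw).norm.mul hD.norm).intervalIntegrable_of_Icc hab) ?_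
    intro r hr
    have h1 := hyD r hr
    have h2 := neg_le_of_abs_le (abs_real_inner_le_norm (w b - w r) (D r))
    rw [hy r hr, inner_sub_left, real_inner_smul_left] at h1
    rw [inner_sub_left] at h2
    linarith
  rw [hexp, norm_intervalIntegral_sq_eq hab hD, hinner]
  nlinarith [mul_le_mul_of_nonneg_left hle hn]

/-- Comparison estimate for the penalized integral equations: if
`x̂ s = v̂ s - n ∫_t^s δ(x̂ r) dr` and `x̄ s = v s - n ∫_t^s δ(x̄ r) dr` on `[t,T]`,
where `δ x := x - π_C x` with `π_C` the metric projection onto the nonempty closed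
convex set `C ⊆ ℝ^d`, then for every `s ∈ [t,T]`,
`‖x̂ s - x̄ s‖² ≤ ‖v̂ s - v s‖² + 2n ∫_t^s ‖(v̂ s - v s) - (v̂ r - v r)‖ ‖δ(x̂ r) - δ(x̄ r)‖ dr`. -/
theorem stmt6 {d : ℕ}
    (C : Set (EuclideanSpace ℝ (Fin d))) (hC_ne : C.Nonempty)
    (hC_closed : IsClosed C) (hC_conv : Convex ℝ C)
    (π : EuclideanSpace ℝ (Fin d) → EuclideanSpace ℝ (Fin d))
    (hπ : ∀ x, π x ∈ C ∧ ‖x - π x‖ = Metric.infDist x C)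
    (t T : ℝ) (htT : 0 ≤ t) (htT' : t ≤ T) (n : ℝ) (hn : 0 < n)
    (v v' x' x'' : ℝ → EuclideanSpace ℝ (Fin d))
    (hv : ContinuousOn v (Icc t T)) (hv' : ContinuousOn v' (Icc t T))
    (hx' : ContinuousOn x' (Icc t T)) (hx'' : ContinuousOn x'' (Icc t T))
    (heq' : ∀ s ∈ Icc t T, x' s = v' s - n • ∫ r in t..s, (x' r - π (x' r)))
    (heq'' : ∀ s ∈ Icc t T, x'' s = v s - n • ∫ r in t..s, (x'' r - π (x'' r))) :
    ∀ s ∈ Icc t T,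
      ‖x' s - x'' s‖ ^ 2 ≤ ‖v' s - v s‖ ^ 2 +
        2 * n * ∫ r in t..s,
          ‖(v' s - v s) - (v' r - v r)‖ * ‖(x' r - π (x' r)) - (x'' r - π (x'' r))‖ := by
  intro s hs
  have hfirm : ∀ x y, ‖(x - π x) - (y - π y)‖ ^ 2 ≤ inner ℝ (x - y) ((x - π x) - (y - π y)) :=
    fun x y => hC_conv.norm_residual_sub_sq_le_inner (hπ x).1 (hπ y).1 (hπ x).2 (hπ y).2
  have hδ : Continuous fun x => x - π x := by
    refine (LipschitzWith.of_dist_le_mul (K := 1) fun x y => ?_).continuous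
    rw [NNReal.coe_one, one_mul, dist_eq_norm, dist_eq_norm]
    have h1 := (hfirm x y).trans (real_inner_le_norm _ _)
    by_contra! h2
    nlinarith [norm_nonneg (x - y)]
  have hsub : Icc t s ⊆ Icc t T := Icc_subset_Icc_right hs.2
  have hδ' : ContinuousOn (fun r => x' r - π (x' r)) (Icc t s) :=
    hδ.comp_continuousOn (hx'.mono hsub)
  have hδ'' : ContinuousOn (fun r => x'' r - π (x'' r)) (Icc t s) :=
    hδ.comp_continuousOn (hx''.mono hsub)
  refine norm_sq_le_of_eq_sub_smul_integral (w := fun r => v' r - v r)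
    (y := fun r => x' r - x'' r)
    (D := fun r => (x' r - π (x' r)) - (x'' r - π (x'' r))) hs.1 hn.le
    ((hv'.sub hv).mono hsub) (hδ'.sub hδ'') (fun r hr => ?_)
    (fun r _ => (sq_nonneg _).trans (hfirm _ _))
  have hr' : Icc t r ⊆ Icc t s := Icc_subset_Icc_right hr.2
  rw [integral_sub ((hδ'.mono hr').intervalIntegrable_of_Icc hr.1)
    ((hδ''.mono hr').intervalIntegrable_of_Icc hr.1), smul_sub]
  nth_rewrite 1 [heq' r (hsub hr), heq'' r (hsub hr)]
  abel
end

section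
/- Let 0 ≤ t ≤ T, n > 0, and let v, v̂ : [t,T] → ℝ^d be continuous. Suppose x̂, x̄ : [t,T] → ℝ^d are continuous and satisfy x̂(s) = v̂(s) − n ∫_t^s δ(x̂(r)) dr and x̄(s) = v(s) − n ∫_t^s δ(x̄(r)) dr for all s ∈ [t,T]. Then sup_{s ∈ [t,T]} ‖x̂(s) − x̄(s)‖² ≤ sup_{s ∈ [t,T]} ‖v̂(s) − v(s)‖² + 4 (sup_{s ∈ [t,T]} ‖v̂(s) − v(s)‖) · ( n ∫_t^T ‖δ(x̂(r))‖ dr + n ∫_t^T ‖δ(x̄(r))‖ dr ). -/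
open Set intervalIntegral

section Projection

variable {E : Type*} [NormedAddCommGroup E] [InnerProductSpace ℝ E] {C : Set E} {π : E → E}

lemma inner_sub_metricProj_le_zero (hC : Convex ℝ C)
    (hπ : ∀ x, π x ∈ C ∧ ‖x - π x‖ = Metric.infDist x C) (x : E) {w : E} (hw : w ∈ C) :
    inner ℝ (x - π x) (w - π x) ≤ 0 := by
  refine (norm_eq_iInf_iff_real_inner_le_zero hC (hπ x).1).1 ?_ w hw
  rw [(hπ x).2, Metric.infDist_eq_iInf]
  simp only [dist_eq_norm]

lemma norm_sq_metricProj_sub_le_inner (hC : Convex ℝ C)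
    (hπ : ∀ x, π x ∈ C ∧ ‖x - π x‖ = Metric.infDist x C) (x y : E) :
    ‖π x - π y‖ ^ 2 ≤ inner ℝ (x - y) (π x - π y) := by
  have h₁ := inner_sub_metricProj_le_zero hC hπ x (hπ y).1
  have h₂ := inner_sub_metricProj_le_zero hC hπ y (hπ x).1
  rw [← real_inner_self_eq_norm_sq]
  simp only [inner_sub_left, inner_sub_right] at *
  linarith

lemma norm_metricProj_sub_le (hC : Convex ℝ C)
    (hπ : ∀ x, π x ∈ C ∧ ‖x - π x‖ = Metric.infDist x C) (x y : E) :
    ‖π x - π y‖ ≤ ‖x - y‖ := by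
  have h := (norm_sq_metricProj_sub_le_inner hC hπ x y).trans (real_inner_le_norm _ _)
  by_contra! hlt
  nlinarith [norm_nonneg (x - y), norm_nonneg (π x - π y)]

lemma continuous_metricProj (hC : Convex ℝ C)
    (hπ : ∀ x, π x ∈ C ∧ ‖x - π x‖ = Metric.infDist x C) : Continuous π := by
  refine (LipschitzWith.of_dist_le_mul (K := 1) fun x y => ?_).continuous
  simpa [dist_eq_norm] using norm_metricProj_sub_le hC hπ x y

lemma inner_sub_penalization_nonneg (hC : Convex ℝ C)
    (hπ : ∀ x, π x ∈ C ∧ ‖x - π x‖ = Metric.infDist x C) (x y : E) :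
    0 ≤ inner ℝ (x - y) ((x - π x) - (y - π y)) := by
  have h := real_inner_le_norm (x - y) (π x - π y)
  have hle := mul_le_mul_of_nonneg_left (norm_metricProj_sub_le hC hπ x y) (norm_nonneg (x - y))
  rw [sub_sub_sub_comm, inner_sub_right, real_inner_self_eq_norm_mul_norm]
  linarith

end Projection

section Integral

variable {E : Type*} [NormedAddCommGroup E] [InnerProductSpace ℝ E]

lemma continuousOn_integral_Icc {g : ℝ → E} {a b : ℝ} (hab : a ≤ b)
    (hg : ContinuousOn g (Icc a b)) : ContinuousOn (fun r => ∫ u in a..r, g u) (Icc a b) := by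
  have := continuousOn_primitive_interval (μ := MeasureTheory.volume) (f := g) (a := a) (b := b)
    (by rw [uIcc_of_le hab]; exact hg.integrableOn_Icc)
  rwa [uIcc_of_le hab] at this

variable [CompleteSpace E]

lemma norm_sq_integral_eq {g : ℝ → E} {a b : ℝ} (hab : a ≤ b) (hg : ContinuousOn g (Icc a b)) :
    ‖∫ r in a..b, g r‖ ^ 2 = ∫ r in a..b, 2 * inner ℝ (∫ u in a..r, g u) (g r) := by
  have hK := continuousOn_integral_Icc hab hg
  have hderiv : ∀ r ∈ Ioo a b, HasDerivAt (fun r => ‖∫ u in a..r, g u‖ ^ 2)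
      (2 * inner ℝ (∫ u in a..r, g u) (g r)) r := by
    intro r hr
    refine HasDerivAt.norm_sq (integral_hasDerivAt_right ?_ ?_ ?_)
    · exact (hg.mono (Icc_subset_Icc_right hr.2.le)).intervalIntegrable_of_Icc hr.1.le
    · exact (hg.mono Ioo_subset_Icc_self).stronglyMeasurableAtFilter isOpen_Ioo r hr
    · exact hg.continuousAt (Icc_mem_nhds hr.1 hr.2)
  have h := integral_eq_sub_of_hasDerivAt_of_le hab (hK.norm.pow 2) hderiv
    ((continuousOn_const.mul (hK.inner hg)).intervalIntegrable_of_Icc hab)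
  simp [h]

/-- A perturbation `w` whose distance to the primitive of `g` has nonnegative inner product with
`g` controls that distance through the total variation of the primitive. -/
lemma norm_sq_sub_integral_le {w g : ℝ → E} {a b M V : ℝ} (hab : a ≤ b)
    (hg : ContinuousOn g (Icc a b)) (hM : ∀ r ∈ Icc a b, ‖w r‖ ≤ M)
    (hmono : ∀ r ∈ Icc a b, 0 ≤ inner ℝ (w r - ∫ u in a..r, g u) (g r))
    (hV : ∫ r in a..b, ‖g r‖ ≤ V) :
    ‖w b - ∫ r in a..b, g r‖ ^ 2 ≤ ‖w b‖ ^ 2 + 4 * M * V := by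
  have hM0 : 0 ≤ M := (norm_nonneg _).trans (hM a (left_mem_Icc.2 hab))
  have hK := continuousOn_integral_Icc hab hg
  have hsq : ‖∫ r in a..b, g r‖ ^ 2 ≤ 2 * M * V := by
    rw [norm_sq_integral_eq hab hg]
    calc ∫ r in a..b, 2 * inner ℝ (∫ u in a..r, g u) (g r)
        ≤ ∫ r in a..b, 2 * M * ‖g r‖ := by
          refine integral_mono_on hab
            ((continuousOn_const.mul (hK.inner hg)).intervalIntegrable_of_Icc hab)
            ((continuousOn_const.mul hg.norm).intervalIntegrable_of_Icc hab) fun r hr => ?_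
          have h₁ := hmono r hr
          rw [inner_sub_left] at h₁
          have h₂ := (real_inner_le_norm (w r) (g r)).trans
            (mul_le_mul_of_nonneg_right (hM r hr) (norm_nonneg _))
          linarith
      _ = 2 * M * ∫ r in a..b, ‖g r‖ := integral_const_mul _ _
      _ ≤ 2 * M * V := by gcongr
  have hcross : -inner ℝ (w b) (∫ r in a..b, g r) ≤ M * V := by
    refine (neg_le_abs _).trans ((abs_real_inner_le_norm _ _).trans ?_)
    exact mul_le_mul (hM b (right_mem_Icc.2 hab)) ((norm_integral_le_integral_norm hab).trans hV)
      (norm_nonneg _) hM0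
  rw [norm_sub_sq_real]
  linarith

end Integral

/-- Uniform comparison estimate for the penalized integral equations: if
`x̂ s = v̂ s - n ∫_t^s δ(x̂ r) dr` and `x̄ s = v s - n ∫_t^s δ(x̄ r) dr` on `[t,T]`,
where `δ x := x - π_C x` with `π_C` the metric projection onto the nonempty closed
convex set `C ⊆ ℝ^d`, then
`sup_{s∈[t,T]} ‖x̂ s - x̄ s‖² ≤ sup_{s∈[t,T]} ‖v̂ s - v s‖²
  + 4 (sup_{s∈[t,T]} ‖v̂ s - v s‖) (n ∫_t^T ‖δ(x̂ r)‖ dr + n ∫_t^T ‖δ(x̄ r)‖ dr)`. -/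
theorem stmt7 {d : ℕ}
    (C : Set (EuclideanSpace ℝ (Fin d))) (hC_ne : C.Nonempty)
    (hC_closed : IsClosed C) (hC_conv : Convex ℝ C)
    (π : EuclideanSpace ℝ (Fin d) → EuclideanSpace ℝ (Fin d))
    (hπ : ∀ x, π x ∈ C ∧ ‖x - π x‖ = Metric.infDist x C)
    (t T : ℝ) (htT : 0 ≤ t) (htT' : t ≤ T) (n : ℝ) (hn : 0 < n)
    (v v' x' x'' : ℝ → EuclideanSpace ℝ (Fin d))
    (hv : ContinuousOn v (Icc t T)) (hv' : ContinuousOn v' (Icc t T))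
    (hx' : ContinuousOn x' (Icc t T)) (hx'' : ContinuousOn x'' (Icc t T))
    (heq' : ∀ s ∈ Icc t T, x' s = v' s - n • ∫ r in t..s, (x' r - π (x' r)))
    (heq'' : ∀ s ∈ Icc t T, x'' s = v s - n • ∫ r in t..s, (x'' r - π (x'' r))) :
    (⨆ s : Icc t T, ‖x' s - x'' s‖ ^ 2) ≤ (⨆ s : Icc t T, ‖v' s - v s‖ ^ 2) +
      4 * (⨆ s : Icc t T, ‖v' s - v s‖) *
        ((n * ∫ r in t..T, ‖x' r - π (x' r)‖) + (n * ∫ r in t..T, ‖x'' r - π (x'' r)‖)) := by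
  have hδ : Continuous fun x => x - π x := continuous_id.sub (continuous_metricProj hC_conv hπ)
  have hd' := hδ.comp_continuousOn hx'
  have hd'' := hδ.comp_continuousOn hx''
  simp only [Function.comp_def] at hd' hd''
  have hw : ContinuousOn (fun s => v' s - v s) (Icc t T) := hv'.sub hv
  have bdd : ∀ f : ℝ → ℝ, ContinuousOn f (Icc t T) →
      BddAbove (range fun s : Icc t T => f s) := fun f hf => by
    have := isCompact_Icc.bddAbove_image hf
    rwa [image_eq_range] at this
  have : Nonempty (Icc t T) := ⟨⟨t, left_mem_Icc.2 htT'⟩⟩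
  set g : ℝ → EuclideanSpace ℝ (Fin d) :=
    fun r => n • ((x' r - π (x' r)) - (x'' r - π (x'' r))) with hg_def
  have hg : ContinuousOn g (Icc t T) := (hd'.sub hd'').const_smul n
  have hdiff : ∀ s ∈ Icc t T, x' s - x'' s = (v' s - v s) - ∫ r in t..s, g r := by
    intro s hs
    have hsub : Icc t s ⊆ Icc t T := Icc_subset_Icc_right hs.2
    rw [hg_def, integral_smul, integral_sub
      ((hd'.mono hsub).intervalIntegrable_of_Icc hs.1)
      ((hd''.mono hsub).intervalIntegrable_of_Icc hs.1), heq' s hs, heq'' s hs, smul_sub]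
    abel
  have hvar : ∫ r in t..T, ‖g r‖ ≤
      (n * ∫ r in t..T, ‖x' r - π (x' r)‖) + (n * ∫ r in t..T, ‖x'' r - π (x'' r)‖) := by
    have hi' := hd'.norm.intervalIntegrable_of_Icc (μ := MeasureTheory.volume) htT'
    have hi'' := hd''.norm.intervalIntegrable_of_Icc (μ := MeasureTheory.volume) htT'
    rw [← mul_add, ← integral_add hi' hi'', ← integral_const_mul]
    refine integral_mono_on htT' (hg.norm.intervalIntegrable_of_Icc htT')
      ((hi'.add hi'').const_mul n) fun r _ => ?_
    rw [hg_def, norm_smul, Real.norm_of_nonneg hn.le]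
    exact mul_le_mul_of_nonneg_left (norm_sub_le _ _) hn.le
  refine ciSup_le fun ⟨s, hs⟩ => ?_
  have hsub : Icc t s ⊆ Icc t T := Icc_subset_Icc_right hs.2
  have hvar_s : ∫ r in t..s, ‖g r‖ ≤ ∫ r in t..T, ‖g r‖ :=
    integral_mono_interval le_rfl hs.1 hs.2 (Filter.Eventually.of_forall fun _ => norm_nonneg _)
      (hg.norm.intervalIntegrable_of_Icc htT')
  have hmain := norm_sq_sub_integral_le (w := fun s => v' s - v s) hs.1 (hg.mono hsub)
    (fun r hr => le_ciSup (bdd _ hw.norm) ⟨r, hsub hr⟩)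
    (fun r hr => by
      rw [← hdiff r (hsub hr), hg_def, real_inner_smul_right]
      exact mul_nonneg hn.le (inner_sub_penalization_nonneg hC_conv hπ _ _))
    (hvar_s.trans hvar)
  rw [← hdiff s hs] at hmain
  exact hmain.trans (add_le_add_left (le_ciSup (bdd _ (hw.norm.pow 2)) ⟨s, hs⟩) _)
end
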